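/- (The big passage property.) Let 1 ≤ m ≤ M ≤ n, let Π ∈ H_{2,n}(q) be a finite product of k loopings all of whose indices lie in the interval [m,M], let i ∈ [m, M−1], and let ε ∈ {1,−1}. Then gᵢ^ε Π lies in the ℤ[q,q⁻¹]-submodule of H_{2,n}(q) spanned by all elements of the form Π₁ gᵢ^ε and Π₂, where Π₁ and Π₂ range over the finite products of k loopings with indices in [m,M]. (Lemma 2, item (8).) -/

import Mathlib

noncomputable section

namespace MixedHecke

/-- The ring `ℤ[q,q⁻¹]` of Laurent polynomials over `ℤ`. -/
abbrev R : Type := LaurentPolynomial ℤ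

/-- The variable `q`. -/
def q : R := LaurentPolynomial.T 1

/-- The inverse `q⁻¹` of the variable `q`. -/
def qinv : R := LaurentPolynomial.T (-1)

/-- Generators of the mixed braid group `B_{2,n}`:
`Sum.inl true` is `𝒯`, `Sum.inl false` is `τ`, and `Sum.inr ⟨i, _⟩` is `σ_i` for `1 ≤ i ≤ n-1`. -/
def Gen (n : ℕ) : Type := Bool ⊕ {i : ℕ // 1 ≤ i ∧ i < n}

/-- The generator `𝒯` in the free group. -/
def fT (n : ℕ) : FreeGroup (Gen n) := FreeGroup.of (Sum.inl true)

/-- The generator `τ` in the free group. -/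
def ftau (n : ℕ) : FreeGroup (Gen n) := FreeGroup.of (Sum.inl false)

/-- The generator `σ_i` in the free group (junk value `1` for `i` out of range). -/
def fs (n i : ℕ) : FreeGroup (Gen n) :=
  if h : 1 ≤ i ∧ i < n then FreeGroup.of (Sum.inr ⟨i, h⟩) else 1

/-- The defining relators of the mixed braid group `B_{2,n}`. -/
def rels (n : ℕ) : Set (FreeGroup (Gen n)) :=
  { x | (∃ k j, 1 ≤ j ∧ j + 1 < k ∧ k < n ∧
          x = fs n k * fs n j * (fs n j * fs n k)⁻¹) ∨
        (∃ k, 1 ≤ k ∧ k + 1 < n ∧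
          x = fs n k * fs n (k+1) * fs n k * (fs n (k+1) * fs n k * fs n (k+1))⁻¹) ∨
        (∃ k, 2 ≤ k ∧ k < n ∧ x = fT n * fs n k * (fs n k * fT n)⁻¹) ∨
        (∃ k, 2 ≤ k ∧ k < n ∧ x = ftau n * fs n k * (fs n k * ftau n)⁻¹) ∨
        (1 < n ∧ x = fT n * fs n 1 * fT n * fs n 1 * (fs n 1 * fT n * fs n 1 * fT n)⁻¹) ∨
        (1 < n ∧ x = ftau n * fs n 1 * ftau n * fs n 1 * (fs n 1 * ftau n * fs n 1 * ftau n)⁻¹) ∨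
        (1 < n ∧ x = ftau n * (fs n 1 * fT n * fs n 1) * ((fs n 1 * fT n * fs n 1) * ftau n)⁻¹) }

/-- The mixed braid group `B_{2,n}` on two fixed strands. -/
abbrev B (n : ℕ) : Type := PresentedGroup (rels n)

/-- The group algebra `ℤ[q,q⁻¹] B_{2,n}`. -/
abbrev GA (n : ℕ) : Type := MonoidAlgebra R (B n)

/-- The image of `σ_i` in the group algebra. -/
def gA (n i : ℕ) : GA n := MonoidAlgebra.of R (B n) (PresentedGroup.mk (rels n) (fs n i))

/-- The quadratic relations `σ_i² = (q-1)σ_i + q·1`, `i = 1, …, n-1`. -/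
inductive quadRel (n : ℕ) : GA n → GA n → Prop
  | intro (i : ℕ) (h1 : 1 ≤ i) (h2 : i < n) :
      quadRel n (gA n i * gA n i) ((q - 1) • gA n i + q • (1 : GA n))

/-- The mixed Hecke algebra `H_{2,n}(q)`: the quotient of the group algebra `ℤ[q,q⁻¹] B_{2,n}`
by the two-sided ideal generated by the quadratic relations. -/
abbrev H (n : ℕ) : Type := RingQuot (quadRel n)

/-- The canonical monoid homomorphism `B_{2,n} →* H_{2,n}(q)`. -/
def π (n : ℕ) : B n →* H n :=
  (RingQuot.mkAlgHom R (quadRel n)).toMonoidHom.comp (MonoidAlgebra.of R (B n))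

/-- The canonical map from the free group on the generators to the units of `H_{2,n}(q)`
(images of group elements are units). -/
def U (n : ℕ) : FreeGroup (Gen n) →* (H n)ˣ :=
  ((π n).comp (PresentedGroup.mk (rels n))).toHomUnits

/-- The braiding generator `g_i` as a unit of `H_{2,n}(q)`. -/
def g (n i : ℕ) : (H n)ˣ := U n (fs n i)

/-- The word for the looping element `𝒯_i` : `𝒯_1 = 𝒯` and `𝒯_{i+1} = σ_i 𝒯_i σ_i`,
i.e. `𝒯_i = σ_{i-1} ⋯ σ_1 𝒯 σ_1 ⋯ σ_{i-1}`. -/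
def wT (n : ℕ) : ℕ → FreeGroup (Gen n)
  | 0 => 1
  | 1 => fT n
  | (i+2) => fs n (i+1) * wT n (i+1) * fs n (i+1)

/-- The word for the looping element `τ_i` : `τ_1 = τ` and `τ_{i+1} = σ_i τ_i σ_i`,
i.e. `τ_i = σ_{i-1} ⋯ σ_1 τ σ_1 ⋯ σ_{i-1}`. -/
def wtau (n : ℕ) : ℕ → FreeGroup (Gen n)
  | 0 => 1
  | 1 => ftau n
  | (i+2) => fs n (i+1) * wtau n (i+1) * fs n (i+1)

/-- The looping element `𝒯_i` as a unit of `H_{2,n}(q)`. -/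
def T (n i : ℕ) : (H n)ˣ := U n (wT n i)

/-- The looping element `τ_i` as a unit of `H_{2,n}(q)`. -/
def tau (n i : ℕ) : (H n)ˣ := U n (wtau n i)

/-- The loopings of index `i` : `𝒯_i, τ_i, 𝒯_i⁻¹, τ_i⁻¹`, as units of `H_{2,n}(q)`. -/
def LoopU (n i : ℕ) : Set (H n)ˣ := {T n i, tau n i, (T n i)⁻¹, (tau n i)⁻¹}

/-- The braiding generators `g_i`, `1 ≤ i ≤ n-1`, as elements of `H_{2,n}(q)`. -/
def BraidGens (n : ℕ) : Set (H n) := {x | ∃ i, 1 ≤ i ∧ i < n ∧ x = (g n i : H n)}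

/-- The elements `g_i^{±1}` with `lo ≤ i ≤ hi - 1`, as elements of `H_{2,n}(q)`. -/
def BraidPM (n lo hi : ℕ) : Set (H n) :=
  {x | ∃ i, lo ≤ i ∧ i < hi ∧ (x = (g n i : H n) ∨ x = ((g n i)⁻¹ : (H n)ˣ))}

section Group

variable {G : Type*} [Group G] {n : ℕ} {s L : ℕ → G}

theorem commute_of_lt_index
    (hfar : ∀ k j, 1 ≤ j → j + 1 < k → k < n → Commute (s k) (s j))
    (hL1 : ∀ k, 2 ≤ k → k < n → Commute (s k) (L 1))
    (hL : ∀ j, 1 ≤ j → L (j + 1) = s j * L j * s j)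
    {i j : ℕ} (hj : 1 ≤ j) (hji : j < i) (hi : i < n) : Commute (s i) (L j) := by
  induction j, hj using Nat.le_induction with
  | base => exact hL1 i hji hi
  | succ j hj ih =>
    rw [hL j hj]
    have h := hfar i j hj hji hi
    exact (h.mul_right (ih (by lia))).mul_right h

theorem commute_of_index_lt
    (hfar : ∀ k j, 1 ≤ j → j + 1 < k → k < n → Commute (s k) (s j))
    (hbraid : ∀ k, 1 ≤ k → k + 1 < n → s k * s (k + 1) * s k = s (k + 1) * s k * s (k + 1))
    (hL1 : ∀ k, 2 ≤ k → k < n → Commute (s k) (L 1))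
    (hL : ∀ j, 1 ≤ j → L (j + 1) = s j * L j * s j)
    {i j : ℕ} (hi : 1 ≤ i) (hij : i + 2 ≤ j) (hj : j ≤ n) : Commute (s i) (L j) := by
  induction j, hij using Nat.le_induction with
  | base =>
    have hb := hbraid i hi (by lia)
    have hc : s (i + 1) * L i = L i * s (i + 1) :=
      commute_of_lt_index hfar hL1 hL hi (by lia) (by lia)
    rw [hL (i + 1) (by lia), hL i hi, commute_iff_eq]
    calc s i * (s (i + 1) * (s i * L i * s i) * s (i + 1))
        = s i * s (i + 1) * s i * L i * s i * s (i + 1) := by group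
      _ = s (i + 1) * s i * (s (i + 1) * L i) * s i * s (i + 1) := by rw [hb]; group
      _ = s (i + 1) * s i * L i * (s (i + 1) * s i * s (i + 1)) := by rw [hc]; group
      _ = s (i + 1) * (s i * L i * s i) * s (i + 1) * s i := by rw [← hb]; group
  | succ j hij ih =>
    rw [hL j (by lia)]
    have h := (hfar j i hi (by lia) (by lia)).symm
    exact (h.mul_right (ih (by lia))).mul_right h

theorem inv_eq_mul_inv_mul {u x y : G} (h : y = u * x * u) : x⁻¹ = u * y⁻¹ * u := by
  rw [h]; group

end Group

section Algebra

variable {K A : Type*} [CommRing K] [Ring A] [Algebra K A]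

/-- The span of the elements `b * u` and `b`, for `b` a product of `k` members of `S`. -/
def passageSpan (K : Type*) [CommRing K] [Algebra K A] (S : Set Aˣ) (u : Aˣ) (k : ℕ) :
    Submodule K A :=
  Submodule.span K {x | ∃ l : List Aˣ, l.length = k ∧ (∀ a ∈ l, a ∈ S) ∧
    (x = (l.prod : Aˣ) * (u : A) ∨ x = (l.prod : Aˣ))}

theorem mul_prod_mem_passageSpan {S : Set Aˣ} {u : Aˣ}
    (h : ∀ a ∈ S, (u * a : A) ∈ passageSpan K S u 1) (l : List Aˣ) (hl : ∀ a ∈ l, a ∈ S) :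
    (u * (l.prod : Aˣ) : A) ∈ passageSpan K S u l.length := by
  induction l with
  | nil => exact Submodule.subset_span ⟨[], rfl, by simp, Or.inl (by simp)⟩
  | cons a l ih =>
    simp only [List.mem_cons, forall_eq_or_imp] at hl
    specialize ih hl.2
    have key : ∀ x ∈ passageSpan K S u 1,
        x * (l.prod : Aˣ) ∈ passageSpan K S u (l.length + 1) := by
      intro x hx
      induction hx using Submodule.span_induction with
      | zero => simp
      | add x y _ _ hx hy => rw [add_mul]; exact add_mem hx hy
      | smul c x _ hx => rw [smul_mul_assoc]; exact Submodule.smul_mem _ c hx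
      | mem x hx =>
        obtain ⟨l₁, hl₁, hS, rfl | rfl⟩ := hx
        · rw [mul_assoc]
          generalize (u * (l.prod : Aˣ) : A) = y at ih
          induction ih using Submodule.span_induction with
          | zero => simp
          | add x y _ _ hx hy => rw [mul_add]; exact add_mem hx hy
          | smul c x _ hx => rw [mul_smul_comm]; exact Submodule.smul_mem _ c hx
          | mem x hx =>
            obtain ⟨l₂, hl₂, hS₂, h₂⟩ := hx
            refine Submodule.subset_span ⟨l₁ ++ l₂, by simp [hl₁, hl₂, add_comm], ?_, ?_⟩
            · intro a ha
              exact (List.mem_append.1 ha).elim (hS a) (hS₂ a)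
            · rcases h₂ with rfl | rfl
              · exact Or.inl (by simp [mul_assoc])
              · exact Or.inr (by simp)
        · refine Submodule.subset_span ⟨l₁ ++ l, by simp [hl₁, add_comm], ?_, Or.inr (by simp)⟩
          intro a ha
          exact (List.mem_append.1 ha).elim (hS a) (hl.2 a)
    simpa [mul_assoc] using key _ (h a hl.1)

theorem mem_passageSpan_one {S : Set Aˣ} (u : Aˣ) {b : Aˣ} (hb : b ∈ S) :
    (b : A) ∈ passageSpan K S u 1 :=
  Submodule.subset_span ⟨[b], by simp [hb]⟩

theorem mul_mem_passageSpan_one {S : Set Aˣ} (u : Aˣ) {b : Aˣ} (hb : b ∈ S) :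
    (b * u : A) ∈ passageSpan K S u 1 :=
  Submodule.subset_span ⟨[b], by simp [hb]⟩

theorem passage_of_commute {S : Set Aˣ} {u a : Aˣ} (h : Commute u a) (ha : a ∈ S) :
    (u * a : A) ∈ passageSpan K S u 1 := by
  rw [← Units.val_mul, h.eq, Units.val_mul]
  exact mul_mem_passageSpan_one u ha

theorem passage_of_conj {S : Set Aˣ} {u x y : Aˣ} {α β γ δ : K}
    (hquad : (u * u : A) = α • (u : A) + β • (1 : A))
    (hinv : ((u⁻¹ : Aˣ) : A) = γ • (u : A) + δ • (1 : A))
    (hxy : y = u * x * u) (hx : x ∈ S) (hy : y ∈ S) :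
    (u * x : A) ∈ passageSpan K S u 1 ∧ (u * y : A) ∈ passageSpan K S u 1 := by
  constructor
  · have h : (u * x : A) = γ • (y * u : A) + δ • (y : A) := by
      calc (u * x : A) = y * (u⁻¹ : Aˣ) := by
            rw [← Units.val_mul, ← Units.val_mul, hxy]; simp
        _ = _ := by rw [hinv, mul_add, mul_smul_comm, mul_smul_comm, mul_one]
    rw [h]
    exact add_mem (Submodule.smul_mem _ _ (mul_mem_passageSpan_one u hy))
      (Submodule.smul_mem _ _ (mem_passageSpan_one u hy))
  · have h : (u * y : A) = α • (y : A) + β • (x * u : A) := by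
      calc (u * y : A) = (u * u : A) * x * u := by rw [hxy]; simp [mul_assoc]
        _ = _ := by rw [hquad, hxy]; simp [add_mul]
    rw [h]
    exact add_mem (Submodule.smul_mem _ _ (mem_passageSpan_one u hy))
      (Submodule.smul_mem _ _ (mul_mem_passageSpan_one u hx))

end Algebra

section Relations

variable {n : ℕ}

theorem U_eq_of_rel {a b : FreeGroup (Gen n)} (h : a * b⁻¹ ∈ rels n) : U n a = U n b := by
  have h1 : PresentedGroup.mk (rels n) a = PresentedGroup.mk (rels n) b := by
    rw [← mul_inv_eq_one, ← map_inv, ← map_mul]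
    exact PresentedGroup.one_of_mem h
  apply Units.ext
  change π n (PresentedGroup.mk (rels n) a) = π n (PresentedGroup.mk (rels n) b)
  rw [h1]

theorem g_commute (k j : ℕ) (hj : 1 ≤ j) (hjk : j + 1 < k) (hk : k < n) :
    Commute (g n k) (g n j) := by
  have h : U n (fs n k * fs n j) = U n (fs n j * fs n k) :=
    U_eq_of_rel (Or.inl ⟨k, j, hj, hjk, hk, rfl⟩)
  rwa [map_mul, map_mul] at h

theorem g_braid (k : ℕ) (hk : 1 ≤ k) (hkn : k + 1 < n) :
    g n k * g n (k + 1) * g n k = g n (k + 1) * g n k * g n (k + 1) := by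
  have h : U n (fs n k * fs n (k + 1) * fs n k) = U n (fs n (k + 1) * fs n k * fs n (k + 1)) :=
    U_eq_of_rel (Or.inr (Or.inl ⟨k, hk, hkn, rfl⟩))
  simp only [map_mul] at h
  exact h

theorem g_commute_T_one (k : ℕ) (hk : 2 ≤ k) (hkn : k < n) : Commute (g n k) (T n 1) := by
  have h : U n (fT n * fs n k) = U n (fs n k * fT n) :=
    U_eq_of_rel (Or.inr (Or.inr (Or.inl ⟨k, hk, hkn, rfl⟩)))
  rw [map_mul, map_mul] at h
  exact h.symm

theorem g_commute_tau_one (k : ℕ) (hk : 2 ≤ k) (hkn : k < n) : Commute (g n k) (tau n 1) := by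
  have h : U n (ftau n * fs n k) = U n (fs n k * ftau n) :=
    U_eq_of_rel (Or.inr (Or.inr (Or.inr (Or.inl ⟨k, hk, hkn, rfl⟩))))
  rw [map_mul, map_mul] at h
  exact h.symm

theorem T_succ (j : ℕ) (hj : 1 ≤ j) : T n (j + 1) = g n j * T n j * g n j := by
  obtain ⟨j, rfl⟩ := Nat.exists_eq_add_of_le' hj
  simp only [T, g, wT, map_mul]

theorem tau_succ (j : ℕ) (hj : 1 ≤ j) : tau n (j + 1) = g n j * tau n j * g n j := by
  obtain ⟨j, rfl⟩ := Nat.exists_eq_add_of_le' hj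
  simp only [tau, g, wtau, map_mul]

theorem g_commute_loop {i j : ℕ} (hi : 1 ≤ i) (hin : i < n) (hj : 1 ≤ j) (hjn : j ≤ n)
    (h₁ : j ≠ i) (h₂ : j ≠ i + 1) {a : (H n)ˣ} (ha : a ∈ LoopU n j) : Commute (g n i) a := by
  have key : ∀ L : ℕ → (H n)ˣ, (∀ k, 2 ≤ k → k < n → Commute (g n k) (L 1)) →
      (∀ j, 1 ≤ j → L (j + 1) = g n j * L j * g n j) → Commute (g n i) (L j) := by
    intro L hL1 hL
    rcases lt_or_gt_of_ne h₁ with h | h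
    · exact commute_of_lt_index g_commute hL1 hL hj h hin
    · exact commute_of_index_lt g_commute g_braid hL1 hL hi (by lia) hjn
  have hT := key (T n) g_commute_T_one T_succ
  have htau := key (tau n) g_commute_tau_one tau_succ
  rcases ha with rfl | rfl | rfl | rfl
  exacts [hT, htau, hT.inv_right, htau.inv_right]

theorem g_mul_self (i : ℕ) (hi : 1 ≤ i) (hin : i < n) :
    (g n i * g n i : H n) = (q - 1) • (g n i : H n) + q • (1 : H n) := by
  have h := RingQuot.mkAlgHom_rel R (quadRel.intro (n := n) i hi hin)
  simp only [map_add, map_mul, map_smul, map_one] at h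
  exact h

theorem qinv_mul_q : qinv * q = 1 := by
  rw [qinv, q, ← LaurentPolynomial.T_add]
  simp

theorem g_inv (i : ℕ) (hi : 1 ≤ i) (hin : i < n) :
    (((g n i)⁻¹ : (H n)ˣ) : H n) = qinv • (g n i : H n) + (qinv - 1) • (1 : H n) := by
  have h := congrArg (fun x => qinv • (x * (((g n i)⁻¹ : (H n)ˣ) : H n))) (g_mul_self i hi hin)
  simp only [mul_assoc, Units.mul_inv, mul_one, add_mul, smul_mul_assoc, one_mul, smul_add,
    smul_smul, qinv_mul_q, mul_sub, one_smul] at h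
  rw [h, ← sub_eq_zero]
  module

theorem g_inv_mul_self (i : ℕ) (hi : 1 ≤ i) (hin : i < n) :
    ((((g n i)⁻¹ : (H n)ˣ) : H n) * (((g n i)⁻¹ : (H n)ˣ) : H n)) =
      (qinv - 1) • (((g n i)⁻¹ : (H n)ˣ) : H n) + qinv • (1 : H n) := by
  nth_rewrite 1 [g_inv i hi hin]
  rw [add_mul, smul_mul_assoc, Units.mul_inv, smul_mul_assoc, one_mul, add_comm]

theorem g_eq (i : ℕ) (hi : 1 ≤ i) (hin : i < n) :
    (g n i : H n) = q • (((g n i)⁻¹ : (H n)ˣ) : H n) + (q - 1) • (1 : H n) := by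
  rw [g_inv i hi hin, smul_add, smul_smul, smul_smul, mul_sub, mul_comm q qinv, qinv_mul_q]
  module

end Relations

/-- The loopings with index in `[m, M]`. -/
def loopings (n m M : ℕ) : Set (H n)ˣ := {a | ∃ j, (m ≤ j ∧ j ≤ M) ∧ a ∈ LoopU n j}

/-- Passage of `u` through a single looping, for `u = g_i` and `u = g_i⁻¹` alike: the order of
the indices `c, d` of the loopings that `u` exchanges depends on the sign. -/
theorem mul_looping_mem {n m M c d : ℕ} {u : (H n)ˣ} {α β γ δ : R}
    (hquad : (u * u : H n) = α • (u : H n) + β • (1 : H n))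
    (hinv : ((u⁻¹ : (H n)ˣ) : H n) = γ • (u : H n) + δ • (1 : H n))
    (hc : m ≤ c ∧ c ≤ M) (hd : m ≤ d ∧ d ≤ M)
    (hT : T n d = u * T n c * u) (htau : tau n d = u * tau n c * u)
    (hcomm : ∀ j, m ≤ j → j ≤ M → j ≠ c → j ≠ d → ∀ a ∈ LoopU n j, Commute u a)
    (a : (H n)ˣ) (ha : a ∈ loopings n m M) :
    (u * a : H n) ∈ passageSpan R (loopings n m M) u 1 := by
  have mem {j : ℕ} (hj : m ≤ j ∧ j ≤ M) {b : (H n)ˣ} (hb : b ∈ LoopU n j) :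
      b ∈ loopings n m M := ⟨j, hj, hb⟩
  have hinvT : (T n c)⁻¹ = u * (T n d)⁻¹ * u := inv_eq_mul_inv_mul hT
  have hinvtau : (tau n c)⁻¹ = u * (tau n d)⁻¹ * u := inv_eq_mul_inv_mul htau
  have pass {x y : (H n)ˣ} (h : y = u * x * u) (hx : x ∈ loopings n m M)
      (hy : y ∈ loopings n m M) : (u * x : H n) ∈ passageSpan R (loopings n m M) u 1 ∧
        (u * y : H n) ∈ passageSpan R (loopings n m M) u 1 :=
    passage_of_conj (K := R) (A := H n) hquad hinv h hx hy
  have h₁ := pass hT (mem hc (by simp [LoopU])) (mem hd (by simp [LoopU]))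
  have h₂ := pass htau (mem hc (by simp [LoopU])) (mem hd (by simp [LoopU]))
  have h₃ := pass hinvT (mem hd (by simp [LoopU])) (mem hc (by simp [LoopU]))
  have h₄ := pass hinvtau (mem hd (by simp [LoopU])) (mem hc (by simp [LoopU]))
  obtain ⟨j, hj, haj⟩ := ha
  by_cases hjc : j = c
  · subst hjc
    rcases haj with rfl | rfl | rfl | rfl
    exacts [h₁.1, h₂.1, h₃.2, h₄.2]
  by_cases hjd : j = d
  · subst hjd
    rcases haj with rfl | rfl | rfl | rfl
    exacts [h₁.2, h₂.2, h₃.1, h₄.1]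
  exact passage_of_commute (hcomm j hj.1 hj.2 hjc hjd a haj) (mem hj haj)

theorem g_zpow_mul_looping_mem {n m M i : ℕ} (hm : 1 ≤ m) (hMn : M ≤ n) (hi1 : m ≤ i)
    (hi2 : i < M) {ε : ℤ} (hε : ε = 1 ∨ ε = -1) (a : (H n)ˣ) (ha : a ∈ loopings n m M) :
    (((g n i ^ ε : (H n)ˣ) : H n) * (a : H n)) ∈
      passageSpan R (loopings n m M) (g n i ^ ε) 1 := by
  have hi : 1 ≤ i := hm.trans hi1
  have hin : i < n := by lia
  have hc : m ≤ i ∧ i ≤ M := ⟨hi1, hi2.le⟩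
  have hd : m ≤ i + 1 ∧ i + 1 ≤ M := ⟨by lia, hi2⟩
  rcases hε with rfl | rfl
  · rw [zpow_one]
    exact mul_looping_mem (g_mul_self i hi hin) (g_inv i hi hin) hc hd (T_succ i hi)
      (tau_succ i hi) (fun j hj hjM h₁ h₂ a ha =>
        g_commute_loop hi hin (hm.trans hj) (hjM.trans hMn) h₁ h₂ ha) a ha
  · rw [zpow_neg_one]
    exact mul_looping_mem (g_inv_mul_self i hi hin)
      (by rw [inv_inv]; exact g_eq i hi hin) hd hc
      (by rw [T_succ i hi]; group) (by rw [tau_succ i hi]; group)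
      (fun j hj hjM h₁ h₂ a ha =>
        (g_commute_loop hi hin (hm.trans hj) (hjM.trans hMn) h₂ h₁ ha).inv_left) a ha

/-- **Lemma 2, item (8): the big passage property.** If `Π` is a finite product of `k`
loopings with indices in `[m,M]` and `i ∈ [m, M-1]`, then `g_i^ε Π` lies in the
`ℤ[q,q⁻¹]`-submodule spanned by the elements `Π₁ g_i^ε` and `Π₂`, where `Π₁, Π₂` range over
the finite products of `k` loopings with indices in `[m,M]`. -/
theorem bigPassage (n : ℕ) (hn : 1 ≤ n) (m M : ℕ) (hm : 1 ≤ m) (hmM : m ≤ M) (hMn : M ≤ n)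
    (k : ℕ) (idx : Fin k → ℕ) (hidx : ∀ j, m ≤ idx j ∧ idx j ≤ M)
    (t : Fin k → (H n)ˣ) (ht : ∀ j, t j ∈ LoopU n (idx j))
    (i : ℕ) (hi1 : m ≤ i) (hi2 : i < M)
    (ε : ℤ) (hε : ε = 1 ∨ ε = -1) :
    ((g n i ^ ε : (H n)ˣ) : H n) * (((List.ofFn t).prod : (H n)ˣ) : H n) ∈
      Submodule.span R
        {x : H n | ∃ (idx' : Fin k → ℕ) (t' : Fin k → (H n)ˣ),
          (∀ j, m ≤ idx' j ∧ idx' j ≤ M) ∧ (∀ j, t' j ∈ LoopU n (idx' j)) ∧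
          (x = (((List.ofFn t').prod : (H n)ˣ) : H n) * ((g n i ^ ε : (H n)ˣ) : H n) ∨
           x = (((List.ofFn t').prod : (H n)ˣ) : H n))} := by
  have h := mul_prod_mem_passageSpan (K := R) (A := H n)
    (g_zpow_mul_looping_mem hm hMn hi1 hi2 hε) (List.ofFn t) (by
      intro a ha
      obtain ⟨j, rfl⟩ := (List.mem_ofFn' t a).1 ha
      exact ⟨idx j, hidx j, ht j⟩)
  rw [List.length_ofFn] at h
  refine Submodule.span_mono ?_ h
  rintro x ⟨l, rfl, hl, hx⟩
  choose idx' hidx' ht' using fun j : Fin l.length => hl (l.get j) (l.get_mem j)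
  refine ⟨idx', l.get, hidx', ht', ?_⟩
  rwa [List.ofFn_get]

end MixedHecke
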